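/- Let W be a regular multiplicative unitary on a complex Hilbert space H and let V be a representation of W on a Hilbert space N. Then the closed linear span of the slices (id ⊗ ω_{ξ,η})(Σ_{H,N} V) over ξ ∈ H, η ∈ N, i.e. of the operators S_{ξ,η} : H → N determined by ⟨n, S_{ξ,η} h⟩ = ⟨n ⊗ ξ, Σ_{H,N} V (h ⊗ η)⟩, equals K(H, N), the compact operators from H to N. -/

import Mathlib

/-!
Common framework: we axiomatize realizations of Hilbert-space tensor products.
A `TensorPair E F EF` realizes the Hilbert tensor product `E ⊗ F` as the Hilbert
space `EF`: it consists of a bilinear map `(a, b) ↦ a ⊗ b` whose image satisfies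
the characteristic inner-product identity and has total (dense) linear span.
Operators such as the leg operators `X₁₂`, `X₂₃`, `X₁₃`, amplifications `a ⊗ b`,
and the tensor flip `Σ` are then uniquely characterized by their matrix
coefficients against elementary tensors.
-/

noncomputable section

open scoped InnerProductSpace
open ContinuousLinearMap

/-- A realization of the Hilbert tensor product `E ⊗ F` as the Hilbert space `EF`. -/
structure TensorPair (E F EF : Type*)
    [NormedAddCommGroup E] [InnerProductSpace ℂ E]
    [NormedAddCommGroup F] [InnerProductSpace ℂ F]
    [NormedAddCommGroup EF] [InnerProductSpace ℂ EF] where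
  tmul : E →ₗ[ℂ] F →ₗ[ℂ] EF
  inner_tmul : ∀ (a c : E) (b d : F), ⟪tmul a b, tmul c d⟫_ℂ = ⟪a, c⟫_ℂ * ⟪b, d⟫_ℂ
  dense_span : Dense (Submodule.span ℂ {z : EF | ∃ a b, z = tmul a b} : Set EF)

/-- A realization of the threefold Hilbert tensor product `E ⊗ F ⊗ G` as `EFG`. -/
structure TensorTriple (E F G EFG : Type*)
    [NormedAddCommGroup E] [InnerProductSpace ℂ E]
    [NormedAddCommGroup F] [InnerProductSpace ℂ F]
    [NormedAddCommGroup G] [InnerProductSpace ℂ G]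
    [NormedAddCommGroup EFG] [InnerProductSpace ℂ EFG] where
  tmul : E →ₗ[ℂ] F →ₗ[ℂ] G →ₗ[ℂ] EFG
  inner_tmul : ∀ (a a' : E) (b b' : F) (c c' : G),
    ⟪tmul a b c, tmul a' b' c'⟫_ℂ = ⟪a, a'⟫_ℂ * ⟪b, b'⟫_ℂ * ⟪c, c'⟫_ℂ
  dense_span : Dense (Submodule.span ℂ {z : EFG | ∃ a b c, z = tmul a b c} : Set EFG)

/-- The norm-closed linear span `[S]` of a set of vectors/operators. -/
def cspan {V : Type*} [NormedAddCommGroup V] [NormedSpace ℂ V] (S : Set V) : Set V :=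
  closure (Submodule.span ℂ S : Set V)

/-- The set of right-leg slices `(id ⊗ ω_{ξ,η})(X)` of an operator
`X : M₁ ⊗ K₁ → M₂ ⊗ K₂`, i.e. all operators `T : M₁ → M₂` such that
`⟪ζ, T ζ'⟫ = ⟪ζ ⊗ ξ, X (ζ' ⊗ η)⟫` for some `ξ ∈ K₂`, `η ∈ K₁`. -/
def slicesR {M₁ K₁ M₂ K₂ Ha Hb : Type*}
    [NormedAddCommGroup M₁] [InnerProductSpace ℂ M₁]
    [NormedAddCommGroup K₁] [InnerProductSpace ℂ K₁]
    [NormedAddCommGroup M₂] [InnerProductSpace ℂ M₂]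
    [NormedAddCommGroup K₂] [InnerProductSpace ℂ K₂]
    [NormedAddCommGroup Ha] [InnerProductSpace ℂ Ha]
    [NormedAddCommGroup Hb] [InnerProductSpace ℂ Hb]
    (ta : TensorPair M₁ K₁ Ha) (tb : TensorPair M₂ K₂ Hb)
    (X : Ha →L[ℂ] Hb) : Set (M₁ →L[ℂ] M₂) :=
  {T | ∃ (ξ : K₂) (η : K₁), ∀ (ζ : M₂) (ζ' : M₁),
    ⟪ζ, T ζ'⟫_ℂ = ⟪tb.tmul ζ ξ, X (ta.tmul ζ' η)⟫_ℂ}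

/-- The set of left-leg slices `(ω_{ξ,η} ⊗ id)(X)` of an operator
`X : K₁ ⊗ M₁ → K₂ ⊗ M₂`, i.e. all operators `T : M₁ → M₂` such that
`⟪ζ, T ζ'⟫ = ⟪ξ ⊗ ζ, X (η ⊗ ζ')⟫` for some `ξ ∈ K₂`, `η ∈ K₁`. -/
def slicesL {M₁ K₁ M₂ K₂ Ha Hb : Type*}
    [NormedAddCommGroup M₁] [InnerProductSpace ℂ M₁]
    [NormedAddCommGroup K₁] [InnerProductSpace ℂ K₁]
    [NormedAddCommGroup M₂] [InnerProductSpace ℂ M₂]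
    [NormedAddCommGroup K₂] [InnerProductSpace ℂ K₂]
    [NormedAddCommGroup Ha] [InnerProductSpace ℂ Ha]
    [NormedAddCommGroup Hb] [InnerProductSpace ℂ Hb]
    (ta : TensorPair K₁ M₁ Ha) (tb : TensorPair K₂ M₂ Hb)
    (X : Ha →L[ℂ] Hb) : Set (M₁ →L[ℂ] M₂) :=
  {T | ∃ (ξ : K₂) (η : K₁), ∀ (ζ : M₂) (ζ' : M₁),
    ⟪ζ, T ζ'⟫_ℂ = ⟪tb.tmul ξ ζ, X (ta.tmul η ζ')⟫_ℂ}

/-- `Â(X) := [(id ⊗ ω_{ξ,η})(X) : ξ, η ∈ H] ⊆ B(H)` for `X ∈ B(H ⊗ H)`. -/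
def hatA {H H2 : Type*}
    [NormedAddCommGroup H] [InnerProductSpace ℂ H]
    [NormedAddCommGroup H2] [InnerProductSpace ℂ H2]
    (t2 : TensorPair H H H2) (X : H2 →L[ℂ] H2) : Set (H →L[ℂ] H) :=
  cspan (slicesR t2 t2 X)

/-- `A(X) := [(ω_{ξ,η} ⊗ id)(X) : ξ, η ∈ H] ⊆ B(H)` for `X ∈ B(H ⊗ H)`. -/
def legA {H H2 : Type*}
    [NormedAddCommGroup H] [InnerProductSpace ℂ H]
    [NormedAddCommGroup H2] [InnerProductSpace ℂ H2]
    (t2 : TensorPair H H H2) (X : H2 →L[ℂ] H2) : Set (H →L[ℂ] H) :=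
  cspan (slicesL t2 t2 X)

/-- `T` is the tensor-product operator `a ⊗ b : E ⊗ F → E' ⊗ F'`, characterized by its
matrix coefficients against elementary tensors.  In particular `IsTensorOp ta tb a 1 T`
says that `T = a ⊗ 1`, and `IsTensorOp ta tb 1 b T` that `T = 1 ⊗ b`. -/
def IsTensorOp {E F EF E' F' EF' : Type*}
    [NormedAddCommGroup E] [InnerProductSpace ℂ E]
    [NormedAddCommGroup F] [InnerProductSpace ℂ F]
    [NormedAddCommGroup EF] [InnerProductSpace ℂ EF]
    [NormedAddCommGroup E'] [InnerProductSpace ℂ E']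
    [NormedAddCommGroup F'] [InnerProductSpace ℂ F']
    [NormedAddCommGroup EF'] [InnerProductSpace ℂ EF']
    (ta : TensorPair E F EF) (tb : TensorPair E' F' EF')
    (a : E →L[ℂ] E') (b : F →L[ℂ] F') (T : EF →L[ℂ] EF') : Prop :=
  ∀ (ζ : E') (ξ : F') (ζ' : E) (η : F),
    ⟪tb.tmul ζ ξ, T (ta.tmul ζ' η)⟫_ℂ = ⟪ζ, a ζ'⟫_ℂ * ⟪ξ, b η⟫_ℂ

/-- `A ⊗min B := [(a ⊗ 1)(1 ⊗ b) : a ∈ A, b ∈ B] = [a ⊗ b : a ∈ A, b ∈ B]`. -/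
def minTensor {E F EF : Type*}
    [NormedAddCommGroup E] [InnerProductSpace ℂ E]
    [NormedAddCommGroup F] [InnerProductSpace ℂ F]
    [NormedAddCommGroup EF] [InnerProductSpace ℂ EF]
    (t : TensorPair E F EF)
    (A : Set (E →L[ℂ] E)) (B : Set (F →L[ℂ] F)) : Set (EF →L[ℂ] EF) :=
  cspan {T | ∃ a ∈ A, ∃ b ∈ B, IsTensorOp t t a b T}

/-- `Y = X₁₂ = X ⊗ 1` on `E ⊗ F ⊗ G`, for `X ∈ B(E ⊗ F)`. -/
def IsLeg12 {E F G EF EFG : Type*}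
    [NormedAddCommGroup E] [InnerProductSpace ℂ E]
    [NormedAddCommGroup F] [InnerProductSpace ℂ F]
    [NormedAddCommGroup G] [InnerProductSpace ℂ G]
    [NormedAddCommGroup EF] [InnerProductSpace ℂ EF]
    [NormedAddCommGroup EFG] [InnerProductSpace ℂ EFG]
    (t2 : TensorPair E F EF) (t3 : TensorTriple E F G EFG)
    (X : EF →L[ℂ] EF) (Y : EFG →L[ℂ] EFG) : Prop :=
  ∀ (a a' : E) (b b' : F) (c c' : G),
    ⟪t3.tmul a b c, Y (t3.tmul a' b' c')⟫_ℂ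
      = ⟪t2.tmul a b, X (t2.tmul a' b')⟫_ℂ * ⟪c, c'⟫_ℂ

/-- `Y = X₂₃ = 1 ⊗ X` on `E ⊗ F ⊗ G`, for `X ∈ B(F ⊗ G)`. -/
def IsLeg23 {E F G FG EFG : Type*}
    [NormedAddCommGroup E] [InnerProductSpace ℂ E]
    [NormedAddCommGroup F] [InnerProductSpace ℂ F]
    [NormedAddCommGroup G] [InnerProductSpace ℂ G]
    [NormedAddCommGroup FG] [InnerProductSpace ℂ FG]
    [NormedAddCommGroup EFG] [InnerProductSpace ℂ EFG]
    (t2 : TensorPair F G FG) (t3 : TensorTriple E F G EFG)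
    (X : FG →L[ℂ] FG) (Y : EFG →L[ℂ] EFG) : Prop :=
  ∀ (a a' : E) (b b' : F) (c c' : G),
    ⟪t3.tmul a b c, Y (t3.tmul a' b' c')⟫_ℂ
      = ⟪t2.tmul b c, X (t2.tmul b' c')⟫_ℂ * ⟪a, a'⟫_ℂ

/-- `Y = X₁₃ = Σ₁₂X₂₃Σ₁₂` on `E ⊗ F ⊗ G`, for `X ∈ B(E ⊗ G)`: `X` acting on the
first and third legs. -/
def IsLeg13 {E F G EG EFG : Type*}
    [NormedAddCommGroup E] [InnerProductSpace ℂ E]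
    [NormedAddCommGroup F] [InnerProductSpace ℂ F]
    [NormedAddCommGroup G] [InnerProductSpace ℂ G]
    [NormedAddCommGroup EG] [InnerProductSpace ℂ EG]
    [NormedAddCommGroup EFG] [InnerProductSpace ℂ EFG]
    (t2 : TensorPair E G EG) (t3 : TensorTriple E F G EFG)
    (X : EG →L[ℂ] EG) (Y : EFG →L[ℂ] EFG) : Prop :=
  ∀ (a a' : E) (b b' : F) (c c' : G),
    ⟪t3.tmul a b c, Y (t3.tmul a' b' c')⟫_ℂ
      = ⟪t2.tmul a c, X (t2.tmul a' c')⟫_ℂ * ⟪b, b'⟫_ℂ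

section Helpers

variable {E F G EF X : Type*}
    [NormedAddCommGroup E] [InnerProductSpace ℂ E]
    [NormedAddCommGroup F] [InnerProductSpace ℂ F]
    [NormedAddCommGroup G] [InnerProductSpace ℂ G]
    [NormedAddCommGroup EF] [InnerProductSpace ℂ EF]
    [NormedAddCommGroup X] [InnerProductSpace ℂ X]

/-- Induction on the Hilbert tensor product. -/
theorem TensorPair.ind (t : TensorPair E F EF) {P : EF → Prop}
    (hcl : IsClosed {x | P x}) (h0 : P 0) (hadd : ∀ x y, P x → P y → P (x + y))
    (hsmul : ∀ (c : ℂ) x, P x → P (c • x)) (htm : ∀ a b, P (t.tmul a b)) (x : EF) : P x := by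
  have hsub : (Submodule.span ℂ {z : EF | ∃ a b, z = t.tmul a b} : Set EF) ⊆ {x | P x} := by
    intro z hz
    refine Submodule.span_induction (p := fun z _ => P z) ?_ h0 ?_ ?_ hz
    · rintro z ⟨a, b, rfl⟩
      exact htm a b
    · intro x y _ _ hx hy
      exact hadd x y hx hy
    · intro c x _ hx
      exact hsmul c x hx
  exact closure_minimal hsub hcl (t.dense_span x)

theorem TensorPair.norm_tmul (t : TensorPair E F EF) (a : E) (b : F) :
    ‖t.tmul a b‖ = ‖a‖ * ‖b‖ := by
  have h := t.inner_tmul a a b b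
  rw [inner_self_eq_norm_sq_to_K, inner_self_eq_norm_sq_to_K, inner_self_eq_norm_sq_to_K] at h
  have h' : ‖t.tmul a b‖ ^ 2 = (‖a‖ * ‖b‖) ^ 2 := by
    rw [mul_pow]
    exact_mod_cast h
  exact (sq_eq_sq₀ (norm_nonneg _) (by positivity)).1 h'

theorem TensorTriple.ext_inner {EFG : Type*} [NormedAddCommGroup EFG] [InnerProductSpace ℂ EFG]
    (t : TensorTriple E F G EFG) {x y : EFG}
    (h : ∀ a b c, ⟪t.tmul a b c, x⟫_ℂ = ⟪t.tmul a b c, y⟫_ℂ) : x = y := by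
  refine t.dense_span.eq_of_inner_right (𝕜 := ℂ) ?_
  intro v hv
  have : ∀ v ∈ Submodule.span ℂ {z : EFG | ∃ a b c, z = t.tmul a b c}, ⟪v, x⟫_ℂ = ⟪v, y⟫_ℂ := by
    intro v hv
    induction hv using Submodule.span_induction with
    | mem v hv => obtain ⟨a, b, c, rfl⟩ := hv; exact h a b c
    | zero => simp
    | add u w _ _ hu hw => rw [inner_add_left, inner_add_left, hu, hw]
    | smul c u _ hu => rw [inner_smul_left, inner_smul_left, hu]
  exact this _ hv

/-- left tensoring as a bounded bilinear map -/
def TensorPair.tmulL (t : TensorPair E F EF) : E →L[ℂ] F →L[ℂ] EF :=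
  t.tmul.mkContinuous₂ 1 (fun a b => by rw [t.norm_tmul, one_mul])

@[simp] theorem TensorPair.tmulL_apply (t : TensorPair E F EF) (a : E) (b : F) :
    t.tmulL a b = t.tmul a b := rfl

theorem exists_ext [CompleteSpace X] (t : TensorPair E F EF) (g : E →ₗ[ℂ] F →ₗ[ℂ] G →ₗ[ℂ] X)
    (hg : ∀ a b c a' b' c', ⟪g a b c, g a' b' c'⟫_ℂ = ⟪a, a'⟫_ℂ * ⟪b, b'⟫_ℂ * ⟪c, c'⟫_ℂ) :
    ∃ A : EF →L[ℂ] G →L[ℂ] X, ∀ a b c, A (t.tmul a b) c = g a b c := by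
  have hin : ∀ x y : TensorProduct ℂ E F,
      ⟪TensorProduct.lift t.tmul x, TensorProduct.lift t.tmul y⟫_ℂ = ⟪x, y⟫_ℂ := by
    intro x y
    induction x with
    | zero => simp
    | add x x' hx hx' => rw [map_add, inner_add_left, inner_add_left, hx, hx']
    | tmul a b =>
      induction y with
      | zero => simp
      | add x x' hx hx' => rw [map_add, inner_add_right, inner_add_right, hx, hx']
      | tmul a' b' => simp [t.inner_tmul]
  have hin2 : ∀ (x y : TensorProduct ℂ E F) (c c' : G),
      ⟪TensorProduct.lift g x c, TensorProduct.lift g y c'⟫_ℂ = ⟪x, y⟫_ℂ * ⟪c, c'⟫_ℂ := by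
    intro x y c c'
    induction x with
    | zero => simp
    | add x x' hx hx' =>
      rw [map_add, LinearMap.add_apply, inner_add_left, inner_add_left, hx, hx', add_mul]
    | tmul a b =>
      induction y with
      | zero => simp
      | add x x' hx hx' =>
        rw [map_add, LinearMap.add_apply, inner_add_right, inner_add_right, hx, hx', add_mul]
      | tmul a' b' => simp [hg]
  let f : TensorProduct ℂ E F →ₗᵢ[ℂ] EF := (TensorProduct.lift t.tmul).isometryOfInner hin
  have hnorm : ∀ (x : TensorProduct ℂ E F) (c : G),
      ‖TensorProduct.lift g x c‖ ≤ 1 * ‖x‖ * ‖c‖ := by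
    intro x c
    have h := hin2 x x c c
    have hxx : ⟪x, x⟫_ℂ = (‖x‖ : ℂ) ^ 2 := inner_self_eq_norm_sq_to_K x
    rw [inner_self_eq_norm_sq_to_K, inner_self_eq_norm_sq_to_K, hxx] at h
    have h' : ‖TensorProduct.lift g x c‖ ^ 2 = (1 * ‖x‖ * ‖c‖) ^ 2 := by
      rw [one_mul, mul_pow]
      apply Complex.ofReal_injective
      rw [Complex.ofReal_mul, Complex.ofReal_pow, Complex.ofReal_pow, Complex.ofReal_pow]
      exact h
    exact ((sq_eq_sq₀ (norm_nonneg _) (by positivity)).1 h').le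
  have hd : DenseRange f := by
    refine t.dense_span.mono ?_
    intro z hz
    have : Submodule.span ℂ {z : EF | ∃ a b, z = t.tmul a b} ≤ LinearMap.range f.toLinearMap := by
      rw [Submodule.span_le]
      rintro z ⟨a, b, rfl⟩
      exact ⟨a ⊗ₜ[ℂ] b, by simp [f]⟩
    obtain ⟨y, hy⟩ := this hz
    exact ⟨y, hy⟩
  let gcont : TensorProduct ℂ E F →L[ℂ] G →L[ℂ] X := (TensorProduct.lift g).mkContinuous₂ 1 hnorm
  refine ⟨gcont.extend f.toContinuousLinearMap, ?_⟩
  intro a b c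
  have h := ContinuousLinearMap.extend_eq (f := gcont) (e := f.toContinuousLinearMap) hd
    f.isometry.isUniformInducing (a ⊗ₜ[ℂ] b)
  have h2 : f.toContinuousLinearMap (a ⊗ₜ[ℂ] b) = t.tmul a b := by simp [f]
  rw [h2] at h
  rw [h]
  simp [gcont]

/-- A closed subspace of operators containing all rank-one operators contains all compacts. -/
theorem compact_mem [CompleteSpace E] [CompleteSpace F] (C : Submodule ℂ (E →L[ℂ] F))
    (hC : IsClosed (C : Set (E →L[ℂ] F)))
    (h1 : ∀ (x : F) (y : E), InnerProductSpace.rankOne ℂ x y ∈ C)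
    (T : E →L[ℂ] F) (hT : IsCompactOperator T) : T ∈ C := by
  rw [← SetLike.mem_coe, ← hC.closure_eq, Metric.mem_closure_iff]
  intro ε hε
  have hK := hT.isCompact_closure_image_closedBall (f := (T : E →ₗ[ℂ] F)) 1
  obtain ⟨s, hs, hcov⟩ := Metric.totallyBounded_iff.1 hK.totallyBounded (ε / 2) (half_pos hε)
  let M : Submodule ℂ F := Submodule.span ℂ s
  have : FiniteDimensional ℂ M := FiniteDimensional.span_of_finite ℂ hs
  refine ⟨M.starProjection ∘L T, ?_, ?_⟩
  · let b := stdOrthonormalBasis ℂ M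
    have : M.starProjection ∘L T =
        ∑ i, InnerProductSpace.rankOne ℂ (b i : F) (adjoint T (b i : F)) := by
      ext x
      simp only [ContinuousLinearMap.comp_apply, _root_.sum_apply,
        InnerProductSpace.rankOne_apply, adjoint_inner_left]
      rw [Submodule.starProjection_apply, b.orthogonalProjectionOnto_apply_eq_sum (T x)]
      simp
    rw [this]
    exact C.sum_mem fun i _ => h1 _ _
  · rw [dist_eq_norm]
    refine lt_of_le_of_lt ?_ (half_lt_self hε)
    refine ContinuousLinearMap.opNorm_le_of_unit_norm (half_pos hε).le ?_
    intro x hx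
    have hmem : T x ∈ closure ((T : E →ₗ[ℂ] F) '' Metric.closedBall 0 1) :=
      subset_closure ⟨x, by simp [hx], rfl⟩
    obtain ⟨y, hy, hxy⟩ := Set.mem_iUnion₂.1 (hcov hmem)
    have hyM : y ∈ M := Submodule.subset_span hy
    have h := Submodule.starProjection_minimal (U := M) (T x)
    simp only [_root_.sub_apply, ContinuousLinearMap.comp_apply]
    rw [h]
    refine (ciInf_le ⟨0, ?_⟩ (⟨y, hyM⟩ : M)).trans ?_
    · rintro _ ⟨w, rfl⟩
      exact norm_nonneg _
    · rw [Metric.mem_ball, dist_eq_norm] at hxy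
      exact hxy.le

end Helpers

set_option linter.unusedSectionVars false

section Slices

variable {E F EF FE : Type*}
    [NormedAddCommGroup E] [InnerProductSpace ℂ E] [CompleteSpace E]
    [NormedAddCommGroup F] [InnerProductSpace ℂ F] [CompleteSpace F]
    [NormedAddCommGroup EF] [InnerProductSpace ℂ EF] [CompleteSpace EF]
    [NormedAddCommGroup FE] [InnerProductSpace ℂ FE] [CompleteSpace FE]

/-- The slice `h ↦ (ξ^* ⊗ 1) Y (h ⊗ η)`. -/
def slc (t : TensorPair E F EF) (Y : EF →L[ℂ] EF) (ξ : E) (η : F) : E →L[ℂ] F :=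
  adjoint (t.tmulL ξ) ∘L Y ∘L t.tmulL.flip η

theorem inner_slc (t : TensorPair E F EF) (Y : EF →L[ℂ] EF) (ξ : E) (η : F) (n : F) (h : E) :
    ⟪n, slc t Y ξ η h⟫_ℂ = ⟪t.tmul ξ n, Y (t.tmul h η)⟫_ℂ := by
  simp [slc, adjoint_inner_right]

theorem inner_flip (t : TensorPair E F EF) (t' : TensorPair F E FE) (S : EF →L[ℂ] FE)
    (hS : ∀ a b, S (t.tmul a b) = t'.tmul b a) (a : E) (b : F) (x : EF) :
    ⟪t'.tmul b a, S x⟫_ℂ = ⟪t.tmul a b, x⟫_ℂ := by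
  refine t.ind (P := fun x => ⟪t'.tmul b a, S x⟫_ℂ = ⟪t.tmul a b, x⟫_ℂ) ?_ ?_ ?_ ?_ ?_ x
  · exact isClosed_eq (by fun_prop) (by fun_prop)
  · simp
  · intro x y hx hy
    rw [map_add, inner_add_right, inner_add_right, hx, hy]
  · intro c x hx
    rw [map_smul, inner_smul_right, inner_smul_right, hx]
  · intro p q
    rw [hS, t.inner_tmul, t'.inner_tmul, mul_comm]

theorem slices_eq (t : TensorPair E F EF) (t' : TensorPair F E FE) (S : EF →L[ℂ] FE)
    (hS : ∀ a b, S (t.tmul a b) = t'.tmul b a) (Y : EF →L[ℂ] EF) :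
    slicesR t t' (S.comp Y) = {T | ∃ ξ η, T = slc t Y ξ η} := by
  ext T
  constructor
  · rintro ⟨ξ, η, h⟩
    refine ⟨ξ, η, ?_⟩
    ext x
    refine ext_inner_left ℂ fun n => ?_
    rw [h, inner_slc, ContinuousLinearMap.comp_apply, inner_flip t t' S hS]
  · rintro ⟨ξ, η, rfl⟩
    refine ⟨ξ, η, fun n x => ?_⟩
    rw [inner_slc, ContinuousLinearMap.comp_apply, inner_flip t t' S hS]

theorem isCompactOperator_rankOne (x : F) (y : E) :
    IsCompactOperator (InnerProductSpace.rankOne ℂ x y : E →L[ℂ] F) := by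
  rw [InnerProductSpace.rankOne_def']
  exact (isCompactOperator_of_locallyCompactSpace_rng
    (ContinuousLinearMap.toSpanSingleton ℂ x)).comp_clm _

end Slices

section Legs

variable {E F G EF FG EFG : Type*}
    [NormedAddCommGroup E] [InnerProductSpace ℂ E] [CompleteSpace E]
    [NormedAddCommGroup F] [InnerProductSpace ℂ F] [CompleteSpace F]
    [NormedAddCommGroup G] [InnerProductSpace ℂ G] [CompleteSpace G]
    [NormedAddCommGroup EF] [InnerProductSpace ℂ EF] [CompleteSpace EF]
    [NormedAddCommGroup FG] [InnerProductSpace ℂ FG] [CompleteSpace FG]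
    [NormedAddCommGroup EFG] [InnerProductSpace ℂ EFG] [CompleteSpace EFG]

theorem inner_extA (t : TensorPair E F EF) (t3 : TensorTriple E F G EFG)
    (A : EF →L[ℂ] G →L[ℂ] EFG) (hA : ∀ a b c, A (t.tmul a b) c = t3.tmul a b c)
    (a : E) (b : F) (c c' : G) (x : EF) :
    ⟪t3.tmul a b c, A x c'⟫_ℂ = ⟪t.tmul a b, x⟫_ℂ * ⟪c, c'⟫_ℂ := by
  refine t.ind (P := fun x => ⟪t3.tmul a b c, A x c'⟫_ℂ = ⟪t.tmul a b, x⟫_ℂ * ⟪c, c'⟫_ℂ)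
    ?_ ?_ ?_ ?_ ?_ x
  · exact isClosed_eq (by fun_prop) (by fun_prop)
  · simp
  · intro x y hx hy
    rw [map_add, _root_.add_apply, inner_add_right, inner_add_right, hx, hy, add_mul]
  · intro k x hx
    rw [map_smul, _root_.smul_apply, inner_smul_right, inner_smul_right, hx, mul_assoc]
  · intro p q
    rw [hA, t3.inner_tmul, t.inner_tmul]

theorem inner_extB (t : TensorPair F G FG) (t3 : TensorTriple E F G EFG)
    (B : FG →L[ℂ] E →L[ℂ] EFG) (hB : ∀ a b c, B (t.tmul b c) a = t3.tmul a b c)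
    (a a' : E) (b : F) (c : G) (x : FG) :
    ⟪t3.tmul a b c, B x a'⟫_ℂ = ⟪t.tmul b c, x⟫_ℂ * ⟪a, a'⟫_ℂ := by
  refine t.ind (P := fun x => ⟪t3.tmul a b c, B x a'⟫_ℂ = ⟪t.tmul b c, x⟫_ℂ * ⟪a, a'⟫_ℂ)
    ?_ ?_ ?_ ?_ ?_ x
  · exact isClosed_eq (by fun_prop) (by fun_prop)
  · simp
  · intro x y hx hy
    rw [map_add, _root_.add_apply, inner_add_right, inner_add_right, hx, hy, add_mul]
  · intro k x hx
    rw [map_smul, _root_.smul_apply, inner_smul_right, inner_smul_right, hx, mul_assoc]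
  · intro p q
    rw [hB, t3.inner_tmul, t.inner_tmul]
    ring

theorem leg12_star (t : TensorPair E F EF) (t3 : TensorTriple E F G EFG)
    (X : EF →L[ℂ] EF) (Y : EFG →L[ℂ] EFG) (h : IsLeg12 t t3 X Y) :
    IsLeg12 t t3 (star X) (star Y) := by
  intro a a' b b' c c'
  rw [star_eq_adjoint, star_eq_adjoint, adjoint_inner_right, adjoint_inner_right,
    ← inner_conj_symm, h, map_mul, inner_conj_symm, inner_conj_symm]

theorem leg12_tmul (t : TensorPair E F EF) (t3 : TensorTriple E F G EFG)
    (A : EF →L[ℂ] G →L[ℂ] EFG) (hA : ∀ a b c, A (t.tmul a b) c = t3.tmul a b c)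
    (X : EF →L[ℂ] EF) (Y : EFG →L[ℂ] EFG) (h : IsLeg12 t t3 X Y) (a : E) (b : F) (c : G) :
    Y (t3.tmul a b c) = A (X (t.tmul a b)) c := by
  refine t3.ext_inner fun p q r => ?_
  rw [h, inner_extA t t3 A hA]

theorem leg23_tmul (t : TensorPair F G FG) (t3 : TensorTriple E F G EFG)
    (B : FG →L[ℂ] E →L[ℂ] EFG) (hB : ∀ a b c, B (t.tmul b c) a = t3.tmul a b c)
    (X : FG →L[ℂ] FG) (Y : EFG →L[ℂ] EFG) (h : IsLeg23 t t3 X Y) (a : E) (b : F) (c : G) :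
    Y (t3.tmul a b c) = B (X (t.tmul b c)) a := by
  refine t3.ext_inner fun p q r => ?_
  rw [h, inner_extB t t3 B hB]

end Legs

section Main

variable {H H2 N HN HHN : Type*}
    [NormedAddCommGroup H] [InnerProductSpace ℂ H] [CompleteSpace H]
    [NormedAddCommGroup H2] [InnerProductSpace ℂ H2] [CompleteSpace H2]
    [NormedAddCommGroup N] [InnerProductSpace ℂ N] [CompleteSpace N]
    [NormedAddCommGroup HN] [InnerProductSpace ℂ HN] [CompleteSpace HN]
    [NormedAddCommGroup HHN] [InnerProductSpace ℂ HHN] [CompleteSpace HHN]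

/-- The twisted slices `(ω^* ⊗ 1) Y (1 ⊗ θ)`. -/
def phi (A : H2 →L[ℂ] N →L[ℂ] HHN) (B : HN →L[ℂ] H →L[ℂ] HHN) (Y : HHN →L[ℂ] HHN)
    (ω : H2) (θ : HN) : H →L[ℂ] N :=
  adjoint (A ω) ∘L Y ∘L B θ

theorem phi_mem (t2 : TensorPair H H H2) (tHN : TensorPair H N HN)
    (A : H2 →L[ℂ] N →L[ℂ] HHN) (B : HN →L[ℂ] H →L[ℂ] HHN) (Y : HHN →L[ℂ] HHN)
    (P : H2 →L[ℂ] H2) (Q : HN →L[ℂ] HN)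
    (C : Submodule ℂ (H →L[ℂ] N)) (hC : IsClosed (C : Set (H →L[ℂ] N)))
    (h : ∀ ξ η ζ ν, phi A B Y (P (t2.tmul ξ η)) (Q (tHN.tmul ζ ν)) ∈ C) (ω : H2) (θ : HN) :
    phi A B Y (P ω) (Q θ) ∈ C := by
  have h1 : ∀ ξ η, phi A B Y (P (t2.tmul ξ η)) (Q θ) ∈ C := by
    intro ξ η
    refine tHN.ind (P := fun θ => phi A B Y (P (t2.tmul ξ η)) (Q θ) ∈ C) ?_ ?_ ?_ ?_ ?_ θ
    · refine hC.preimage (f := fun θ => phi A B Y (P (t2.tmul ξ η)) (Q θ)) ?_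
      unfold phi
      fun_prop
    · simp [phi]
    · intro x y hx hy
      have : phi A B Y (P (t2.tmul ξ η)) (Q (x + y)) =
          phi A B Y (P (t2.tmul ξ η)) (Q x) + phi A B Y (P (t2.tmul ξ η)) (Q y) := by
        ext; simp [phi]
      rw [this]
      exact C.add_mem hx hy
    · intro c x hx
      have : phi A B Y (P (t2.tmul ξ η)) (Q (c • x)) =
          c • phi A B Y (P (t2.tmul ξ η)) (Q x) := by
        ext; simp [phi]
      rw [this]
      exact C.smul_mem c hx
    · exact h ξ η
  refine t2.ind (P := fun ω => phi A B Y (P ω) (Q θ) ∈ C) ?_ ?_ ?_ ?_ ?_ ω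
  · refine hC.preimage (f := fun ω => phi A B Y (P ω) (Q θ)) ?_
    unfold phi
    have : Continuous fun ω => adjoint (A (P ω)) :=
      (adjoint : (N →L[ℂ] HHN) ≃ₗᵢ⋆[ℂ] (HHN →L[ℂ] N)).continuous.comp (by fun_prop)
    fun_prop
  · simp [phi]
  · intro x y hx hy
    have : phi A B Y (P (x + y)) (Q θ) = phi A B Y (P x) (Q θ) + phi A B Y (P y) (Q θ) := by
      ext; simp [phi]
    rw [this]
    exact C.add_mem hx hy
  · intro c x hx
    have : phi A B Y (P (c • x)) (Q θ) = (starRingEnd ℂ c) • phi A B Y (P x) (Q θ) := by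
      ext
      simp only [phi, map_smul, LinearIsometryEquiv.map_smulₛₗ]
      simp
    rw [this]
    exact C.smul_mem _ hx
  · exact h1

theorem phi_tmul (t2 : TensorPair H H H2) (tHN : TensorPair H N HN)
    (t3 : TensorTriple H H N HHN)
    (A : H2 →L[ℂ] N →L[ℂ] HHN) (hA : ∀ a b c, A (t2.tmul a b) c = t3.tmul a b c)
    (B : HN →L[ℂ] H →L[ℂ] HHN) (hB : ∀ a b c, B (tHN.tmul b c) a = t3.tmul a b c)
    (V : HN →L[ℂ] HN) (V13 : HHN →L[ℂ] HHN) (hV13 : IsLeg13 tHN t3 V V13)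
    (a b ζ : H) (ν : N) :
    phi A B V13 (t2.tmul a b) (tHN.tmul ζ ν) = ⟪b, ζ⟫_ℂ • slc tHN V a ν := by
  ext h
  refine ext_inner_left ℂ fun n => ?_
  simp only [phi, ContinuousLinearMap.comp_apply, adjoint_inner_right, _root_.smul_apply,
    inner_smul_right, inner_slc, hA, hB]
  rw [hV13, mul_comm]

theorem phi_twist (t2 : TensorPair H H H2) (tHN : TensorPair H N HN)
    (t3 : TensorTriple H H N HHN)
    (A : H2 →L[ℂ] N →L[ℂ] HHN) (hA : ∀ a b c, A (t2.tmul a b) c = t3.tmul a b c)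
    (B : HN →L[ℂ] H →L[ℂ] HHN) (hB : ∀ a b c, B (tHN.tmul b c) a = t3.tmul a b c)
    (W : H2 →L[ℂ] H2) (V : HN →L[ℂ] HN) (V23 V13 W12 : HHN →L[ℂ] HHN)
    (hV23 : IsLeg23 tHN t3 V V23) (hW12 : IsLeg12 t2 t3 W W12)
    (hrep : V23 * W12 = W12 * V13 * V23) (ξ η ζ : H) (ν : N) :
    phi A B V13 (star W (t2.tmul ξ η)) (V (tHN.tmul ζ ν)) =
      slc tHN V η ν ∘L slc t2 W ξ ζ := by
  ext h
  refine ext_inner_left ℂ fun n => ?_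
  simp only [phi, ContinuousLinearMap.comp_apply, adjoint_inner_right]
  rw [← leg12_tmul t2 t3 A hA _ _ (leg12_star t2 t3 W W12 hW12),
    ← leg23_tmul tHN t3 B hB V V23 hV23, star_eq_adjoint, adjoint_inner_left]
  have hr := congrArg (fun T : HHN →L[ℂ] HHN => T (t3.tmul h ζ ν)) hrep
  simp only [mul_apply_eq_comp] at hr
  rw [← hr, leg12_tmul t2 t3 A hA W W12 hW12]
  have key : ∀ x : H2, ⟪t3.tmul ξ η n, V23 (A x ν)⟫_ℂ =
      ⟪n, slc tHN V η ν (adjoint (t2.tmulL ξ) x)⟫_ℂ := by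
    intro x
    refine t2.ind (P := fun x => ⟪t3.tmul ξ η n, V23 (A x ν)⟫_ℂ =
      ⟪n, slc tHN V η ν (adjoint (t2.tmulL ξ) x)⟫_ℂ) ?_ ?_ ?_ ?_ ?_ x
    · exact isClosed_eq (by fun_prop) (by fun_prop)
    · simp
    · intro x y hx hy
      simp only [map_add, _root_.add_apply, inner_add_right, hx, hy]
    · intro c x hx
      simp only [map_smul, _root_.smul_apply, inner_smul_right, hx]
    · intro p q
      have : adjoint (t2.tmulL ξ) (t2.tmul p q) = ⟪ξ, p⟫_ℂ • q := by
        refine ext_inner_left ℂ fun k => ?_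
        rw [adjoint_inner_right, TensorPair.tmulL_apply, t2.inner_tmul, inner_smul_right]
      rw [this, hA, hV23, map_smul, inner_smul_right, inner_slc, mul_comm]
  rw [key]
  rfl

end Main

/-- For a regular multiplicative unitary `W` on `H` and a
representation `V` of `W` on `N`, the closed span of the slices
`(id ⊗ ω_{ξ,η})(Σ_{H,N} V)` equals `K(H, N)`. -/
theorem statement12
    {H H2 H3 : Type*}
    [NormedAddCommGroup H] [InnerProductSpace ℂ H] [CompleteSpace H]
    [NormedAddCommGroup H2] [InnerProductSpace ℂ H2] [CompleteSpace H2]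
    [NormedAddCommGroup H3] [InnerProductSpace ℂ H3] [CompleteSpace H3]
    -- realizations of the tensor products H ⊗ H and H ⊗ H ⊗ H
    (t2 : TensorPair H H H2) (t3 : TensorTriple H H H H3)
    -- W is a unitary on H ⊗ H
    (W : H2 →L[ℂ] H2) (hWu : star W * W = 1 ∧ W * star W = 1)
    -- the legs W₁₂, W₂₃, W₁₃ of W on H ⊗ H ⊗ H
    (W12 W23 W13 : H3 →L[ℂ] H3)
    (hW12 : IsLeg12 t2 t3 W W12) (hW23 : IsLeg23 t2 t3 W W23)
    (hW13 : IsLeg13 t2 t3 W W13)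
    -- the pentagon equation W₂₃W₁₂ = W₁₂W₁₃W₂₃
    (hpent : W23 * W12 = W12 * W13 * W23)
    -- the tensor flip Σ on H ⊗ H
    (Sg : H2 →L[ℂ] H2) (hSg : ∀ a b : H, Sg (t2.tmul a b) = t2.tmul b a)
    -- regularity: C(W) = K(H)
    (hreg : hatA t2 (Sg * W) = {T : H →L[ℂ] H | IsCompactOperator T})
    -- V is a unitary representation of W on N
    {N HN NH HHN : Type*}
    [NormedAddCommGroup N] [InnerProductSpace ℂ N] [CompleteSpace N]
    [NormedAddCommGroup HN] [InnerProductSpace ℂ HN] [CompleteSpace HN]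
    [NormedAddCommGroup NH] [InnerProductSpace ℂ NH] [CompleteSpace NH]
    [NormedAddCommGroup HHN] [InnerProductSpace ℂ HHN] [CompleteSpace HHN]
    (tHN : TensorPair H N HN) (tNH : TensorPair N H NH)
    (tHHN : TensorTriple H H N HHN)
    (V : HN →L[ℂ] HN) (hVu : star V * V = 1 ∧ V * star V = 1)
    (V23 V13 W12n : HHN →L[ℂ] HHN)
    (hV23 : IsLeg23 tHN tHHN V V23) (hV13 : IsLeg13 tHN tHHN V V13)
    (hW12n : IsLeg12 t2 tHHN W W12n)
    -- the representation condition V₂₃W₁₂ = W₁₂V₁₃V₂₃ on H ⊗ H ⊗ N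
    (hrep : V23 * W12n = W12n * V13 * V23)
    -- the tensor flip Σ_{H,N} : H ⊗ N → N ⊗ H
    (SgHN : HN →L[ℂ] NH) (hSgHN : ∀ (h : H) (n : N), SgHN (tHN.tmul h n) = tNH.tmul n h) :
    cspan (slicesR tHN tNH (SgHN.comp V)) = {T : H →L[ℂ] N | IsCompactOperator T} := by
  -- the closed span of the slices of `W` and `V`
  have hsW : slicesR t2 t2 (Sg * W) = {T | ∃ ξ η, T = slc t2 W ξ η} :=
    slices_eq t2 t2 Sg hSg W
  rw [slices_eq tHN tNH SgHN hSgHN V]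
  obtain ⟨A, hA⟩ := exists_ext t2 tHHN.tmul
    (fun a b c a' b' c' => tHHN.inner_tmul a a' b b' c c')
  obtain ⟨B, hB'⟩ := exists_ext (G := H) tHN
    (LinearMap.mk₂ ℂ (fun b c => (tHHN.tmul.flip b).flip c)
      (by intros; ext; simp) (by intros; ext; simp) (by intros; ext; simp) (by intros; ext; simp))
    (fun b c a b' c' a' => by
      simp only [LinearMap.mk₂_apply, LinearMap.flip_apply]
      rw [tHHN.inner_tmul]
      ring)
  have hB : ∀ a b c, B (tHN.tmul b c) a = tHHN.tmul a b c := fun a b c => by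
    rw [hB']
    simp
  have hphi1 := phi_tmul t2 tHN tHHN A hA B hB V V13 hV13
  have hphi2 := phi_twist t2 tHN tHHN A hA B hB W V V23 V13 W12n hV23 hW12n hrep
  let K : Submodule ℂ (H →L[ℂ] N) := compactOperator (RingHom.id ℂ) H N
  have hKc : IsClosed (K : Set (H →L[ℂ] N)) := isClosed_setOfPred_isCompactOperator
  let C : Submodule ℂ (H →L[ℂ] N) :=
    (Submodule.span ℂ {T | ∃ ξ η, T = slc tHN V ξ η}).topologicalClosure
  have hCc : IsClosed (C : Set (H →L[ℂ] N)) := Submodule.isClosed_topologicalClosure _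
  have hslcC : ∀ ξ η, slc tHN V ξ η ∈ C := fun ξ η =>
    Submodule.le_topologicalClosure _ (Submodule.subset_span ⟨ξ, η, rfl⟩)
  change (C : Set (H →L[ℂ] N)) = (K : Set (H →L[ℂ] N))
  rcases subsingleton_or_nontrivial H with hH | hH
  · have hz : ∀ T : H →L[ℂ] N, T = 0 := fun T => by
      ext x
      rw [Subsingleton.elim x 0]
      simp
    ext T
    rw [hz T]
    simp
  have hcomp : ∀ T : H →L[ℂ] H, T ∈ closure
      (Submodule.span ℂ {T | ∃ ξ η, T = slc t2 W ξ η} : Set (H →L[ℂ] H)) ↔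
      IsCompactOperator T := fun T => by
    have := Set.ext_iff.1 hreg T
    unfold hatA cspan at this
    rw [hsW] at this
    exact this
  apply Set.Subset.antisymm
  · -- every slice is compact
    change C ≤ K
    refine Submodule.topologicalClosure_minimal _ ?_ hKc
    rw [Submodule.span_le]
    rintro _ ⟨a, ν, rfl⟩
    have hall := phi_mem t2 tHN A B V13 (star W) V K hKc (fun ξ η ζ ν => by
      rw [hphi2]
      have hc : IsCompactOperator (slc t2 W ξ ζ) :=
        (hcomp _).1 (subset_closure (Submodule.subset_span ⟨ξ, ζ, rfl⟩))
      exact hc.clm_comp (slc tHN V η ν))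
    obtain ⟨b, hb⟩ := exists_ne (0 : H)
    have h := hall (W (t2.tmul a b)) (star V (tHN.tmul b ν))
    have e1 : star W (W (t2.tmul a b)) = t2.tmul a b :=
      congrArg (fun T : H2 →L[ℂ] H2 => T (t2.tmul a b)) hWu.1
    have e2 : V (star V (tHN.tmul b ν)) = tHN.tmul b ν :=
      congrArg (fun T : HN →L[ℂ] HN => T (tHN.tmul b ν)) hVu.2
    rw [e1, e2, hphi1] at h
    exact (Submodule.smul_mem_iff K (inner_self_ne_zero.2 hb : ⟪b, b⟫_ℂ ≠ 0)).1 h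
  · intro T hT
    refine compact_mem C hCc ?_ T hT
    have hall := phi_mem t2 tHN A B V13 1 1 C hCc (fun ξ η ζ ν => by
      change phi A B V13 (t2.tmul ξ η) (tHN.tmul ζ ν) ∈ C
      rw [hphi1]
      exact C.smul_mem _ (hslcC _ _))
    have hprod : ∀ η ν ξ ζ, slc tHN V η ν ∘L slc t2 W ξ ζ ∈ C := fun η ν ξ ζ => by
      rw [← hphi2]
      exact hall _ _
    have hprodK : ∀ η ν (S : H →L[ℂ] H), IsCompactOperator S → slc tHN V η ν ∘L S ∈ C := by
      intro η ν S hS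
      rw [← hcomp] at hS
      let L : (H →L[ℂ] H) →L[ℂ] (H →L[ℂ] N) :=
        ContinuousLinearMap.compL ℂ H H N (slc tHN V η ν)
      have hcl : IsClosed ((C.comap L.toLinearMap : Submodule ℂ (H →L[ℂ] H)) :
          Set (H →L[ℂ] H)) := hCc.preimage L.continuous
      have hle : Submodule.span ℂ {T | ∃ ξ η, T = slc t2 W ξ η} ≤ C.comap L.toLinearMap := by
        rw [Submodule.span_le]
        rintro _ ⟨ξ, ζ, rfl⟩
        exact hprod η ν ξ ζ
      exact closure_minimal hle hcl hS
    intro x y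
    let R : N →L[ℂ] (H →L[ℂ] N) := (InnerProductSpace.rankOne ℂ).flip y
    let D : Submodule ℂ N := C.comap R.toLinearMap
    have hDc : IsClosed (D : Set N) := hCc.preimage R.continuous
    have hDmem : ∀ η ν a, slc tHN V η ν a ∈ D := by
      intro η ν a
      have := hprodK η ν (InnerProductSpace.rankOne ℂ a y) (isCompactOperator_rankOne a y)
      rwa [InnerProductSpace.comp_rankOne] at this
    have hDtop : D = ⊤ := by
      rw [← hDc.submodule_topologicalClosure_eq, Submodule.topologicalClosure_eq_top_iff,
        Submodule.eq_bot_iff]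
      intro n hn
      obtain ⟨η, hη⟩ := exists_ne (0 : H)
      have h0 : ∀ x : HN, ⟪tHN.tmul η n, V x⟫_ℂ = 0 := by
        intro x
        refine tHN.ind (P := fun x => ⟪tHN.tmul η n, V x⟫_ℂ = 0) ?_ ?_ ?_ ?_ ?_ x
        · exact isClosed_eq (by fun_prop) (by fun_prop)
        · simp
        · intro x y hx hy
          rw [map_add, inner_add_right, hx, hy, add_zero]
        · intro c x hx
          rw [map_smul, inner_smul_right, hx, mul_zero]
        · intro a ν
          rw [← inner_slc]
          exact Submodule.inner_left_of_mem_orthogonal (hDmem η ν a) hn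
      have e2 : V (star V (tHN.tmul η n)) = tHN.tmul η n :=
        congrArg (fun T : HN →L[ℂ] HN => T (tHN.tmul η n)) hVu.2
      have h1 := h0 (star V (tHN.tmul η n))
      rw [e2, inner_self_eq_zero, ← norm_eq_zero, tHN.norm_tmul] at h1
      simpa [hη] using h1
    have : x ∈ D := hDtop ▸ Submodule.mem_top
    exact this

end
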